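/- arXiv:1303.7444 — 4 statements merged into one kernel-verified Lean document; each statement's English description precedes it below -/
import Mathlib

section
/- For the reduced 5-dimensional torsion form T, the contraction α := f₅ ⌟ T satisfies α ∧ α = ((b + 2μ/7)² − μ²) · f¹∧f²∧f³∧f⁴. -/
noncomputable section

/-- Euclidean 5-space. -/
abbrev E5 : Type := EuclideanSpace ℝ (Fin 5)

/-- The standard orthonormal basis vectors `f₁, …, f₅` (0-indexed). -/
def f (i : Fin 5) : E5 := EuclideanSpace.single i 1

/-- The alternating 2-form `fⁱ ∧ fʲ` evaluated on two vectors. -/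
def w2 (i j : Fin 5) (X Y : E5) : ℝ := X i * Y j - X j * Y i

/-- The alternating 3-form `fⁱ ∧ fʲ ∧ fᵏ` evaluated on three vectors. -/
def w3 (i j k : Fin 5) (X Y Z : E5) : ℝ :=
  X i * (Y j * Z k - Y k * Z j) - X j * (Y i * Z k - Y k * Z i)
    + X k * (Y i * Z j - Y j * Z i)

/-- The reduced 5-dimensional torsion form
`T = A·f₁₂₅ + t₂₄₅·(f₁₃₅ + f₂₄₅) + t₂₃₅·(−f₁₄₅ + f₂₃₅) + B·f₃₄₅`
with `A := t₁₂₅ + μ/7`, `B := t₃₄₅ + μ/7`. -/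
def Tred (μ t₁₂₅ t₂₄₅ t₂₃₅ t₃₄₅ : ℝ) (X Y Z : E5) : ℝ :=
  (t₁₂₅ + μ / 7) * w3 0 1 4 X Y Z
    + t₂₄₅ * (w3 0 2 4 X Y Z + w3 1 3 4 X Y Z)
    + t₂₃₅ * (-(w3 0 3 4 X Y Z) + w3 1 2 4 X Y Z)
    + (t₃₄₅ + μ / 7) * w3 2 3 4 X Y Z

/-- The wedge square `α ∧ α` of a 2-form `α`, evaluated on four vectors
(the usual shuffle sum). -/
def wedgeSq (α : E5 → E5 → ℝ) (X₁ X₂ X₃ X₄ : E5) : ℝ :=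
  α X₁ X₂ * α X₃ X₄ - α X₁ X₃ * α X₂ X₄ + α X₁ X₄ * α X₂ X₃
    + α X₂ X₃ * α X₁ X₄ - α X₂ X₄ * α X₁ X₃ + α X₃ X₄ * α X₁ X₂

/-- The 4-form `f¹ ∧ f² ∧ f³ ∧ f⁴` on ℝ⁵, evaluated on four vectors. -/
def f1234 (X₁ X₂ X₃ X₄ : E5) : ℝ :=
  Matrix.det (Matrix.of fun (i j : Fin 4) =>
    ![X₁, X₂, X₃, X₄] i (Fin.castLE (by norm_num) j))

/-- The contraction `f₅ ⌟ T`, written out as a 2-form on the span of `f₁, …, f₄`. -/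
theorem Tred_f_four (μ t₁₂₅ t₂₄₅ t₂₃₅ t₃₄₅ : ℝ) (X Y : E5) :
    Tred μ t₁₂₅ t₂₄₅ t₂₃₅ t₃₄₅ (f 4) X Y
      = (t₁₂₅ + μ / 7) * w2 0 1 X Y + t₂₄₅ * w2 0 2 X Y + -t₂₃₅ * w2 0 3 X Y
        + t₂₃₅ * w2 1 2 X Y + t₂₄₅ * w2 1 3 X Y + (t₃₄₅ + μ / 7) * w2 2 3 X Y := by
  simp [Tred, w3, w2, f]
  ring

/-- The 4-form `f¹ ∧ f² ∧ f³ ∧ f⁴` by Laplace expansion along the first two columns. -/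
theorem f1234_eq_w2 (X₁ X₂ X₃ X₄ : E5) :
    f1234 X₁ X₂ X₃ X₄
      = w2 0 1 X₁ X₂ * w2 2 3 X₃ X₄ - w2 0 1 X₁ X₃ * w2 2 3 X₂ X₄
        + w2 0 1 X₁ X₄ * w2 2 3 X₂ X₃ + w2 0 1 X₂ X₃ * w2 2 3 X₁ X₄
        - w2 0 1 X₂ X₄ * w2 2 3 X₁ X₃ + w2 0 1 X₃ X₄ * w2 2 3 X₁ X₂ := by
  simp [f1234, w2, Matrix.det_succ_row_zero, Fin.sum_univ_succ, Fin.succAbove, Fin.castLE]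
  ring

/-- The wedge square of a 2-form in four variables is twice its Pfaffian times the volume form. -/
theorem wedgeSq_eq_pfaffian (a₁₂ a₁₃ a₁₄ a₂₃ a₂₄ a₃₄ : ℝ) (X₁ X₂ X₃ X₄ : E5) :
    wedgeSq (fun X Y => a₁₂ * w2 0 1 X Y + a₁₃ * w2 0 2 X Y + a₁₄ * w2 0 3 X Y
        + a₂₃ * w2 1 2 X Y + a₂₄ * w2 1 3 X Y + a₃₄ * w2 2 3 X Y) X₁ X₂ X₃ X₄
      = 2 * (a₁₂ * a₃₄ - a₁₃ * a₂₄ + a₁₄ * a₂₃) * f1234 X₁ X₂ X₃ X₄ := by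
  rw [f1234_eq_w2]
  simp only [wedgeSq, w2]
  ring

/-- `α := f₅ ⌟ T` satisfies
`α ∧ α = ((b + 2μ/7)² − μ²) · f¹∧f²∧f³∧f⁴` where `b = t₁₂₅ + t₃₄₅`. -/
theorem stmt_3 (μ t₁₂₅ t₂₄₅ t₂₃₅ t₃₄₅ : ℝ)
    (hnorm : μ ^ 2 = (t₁₂₅ + μ / 7) ^ 2 + (t₃₄₅ + μ / 7) ^ 2
      + 2 * t₂₄₅ ^ 2 + 2 * t₂₃₅ ^ 2) :
    ∀ X₁ X₂ X₃ X₄ : E5,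
      wedgeSq (fun X Y => Tred μ t₁₂₅ t₂₄₅ t₂₃₅ t₃₄₅ (f 4) X Y) X₁ X₂ X₃ X₄
        = (((t₁₂₅ + t₃₄₅) + 2 * μ / 7) ^ 2 - μ ^ 2) * f1234 X₁ X₂ X₃ X₄ := by
  intro X₁ X₂ X₃ X₄
  simp only [Tred_f_four]
  rw [wedgeSq_eq_pfaffian]
  congr 1
  linear_combination hnorm
end
end

section
/- For the reduced 5-dimensional torsion form T, let M be the 4×4 real matrix with entries M_{ij} = T(fᵢ, fⱼ, f₅) for i, j ∈ {1,2,3,4}. Then det M = (1/4)·(−b² − (4/7)bμ + (45/49)μ²)². -/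
noncomputable section

/-- The determinant of a skew-symmetric 4×4 matrix is the square of its Pfaffian. -/
theorem det_skew_fin_four {R : Type*} [CommRing R] (a b c d e g : R) :
    Matrix.det !![0, a, b, c; -a, 0, d, e; -b, -d, 0, g; -c, -e, -g, 0]
      = (a * g - b * e + c * d) ^ 2 := by
  simp [Matrix.det_succ_row_zero, Fin.sum_univ_succ, Fin.succAbove]
  ring

/-- The matrix of the contraction of the reduced torsion form with `f₅`. -/
theorem Tred_matrix (μ t₁₂₅ t₂₄₅ t₂₃₅ t₃₄₅ : ℝ) :
    (Matrix.of fun (i j : Fin 4) =>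
        Tred μ t₁₂₅ t₂₄₅ t₂₃₅ t₃₄₅
          (f (Fin.castLE (by norm_num) i)) (f (Fin.castLE (by norm_num) j)) (f 4))
      = !![0, t₁₂₅ + μ / 7, t₂₄₅, -t₂₃₅;
          -(t₁₂₅ + μ / 7), 0, t₂₃₅, t₂₄₅;
          -t₂₄₅, -t₂₃₅, 0, t₃₄₅ + μ / 7;
          -(-t₂₃₅), -t₂₄₅, -(t₃₄₅ + μ / 7), 0] := by
  ext i j
  fin_cases i <;> fin_cases j <;> simp [Tred, w3, f, Fin.castLE, PiLp.single_apply]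

/-- the 4×4 matrix `M_{ij} = T(fᵢ, fⱼ, f₅)` (i,j ∈ {1,…,4}) has
`det M = (1/4)·(−b² − (4/7)bμ + (45/49)μ²)²` where `b = t₁₂₅ + t₃₄₅`. -/
theorem stmt_4 (μ t₁₂₅ t₂₄₅ t₂₃₅ t₃₄₅ : ℝ)
    (hnorm : μ ^ 2 = (t₁₂₅ + μ / 7) ^ 2 + (t₃₄₅ + μ / 7) ^ 2
      + 2 * t₂₄₅ ^ 2 + 2 * t₂₃₅ ^ 2) :
    Matrix.det (Matrix.of fun (i j : Fin 4) =>
        Tred μ t₁₂₅ t₂₄₅ t₂₃₅ t₃₄₅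
          (f (Fin.castLE (by norm_num) i)) (f (Fin.castLE (by norm_num) j)) (f 4))
      = (1 / 4) * (-(t₁₂₅ + t₃₄₅) ^ 2 - (4 / 7) * (t₁₂₅ + t₃₄₅) * μ
          + (45 / 49) * μ ^ 2) ^ 2 := by
  rw [Tred_matrix, det_skew_fin_four]
  have pfaffian_eq : (t₁₂₅ + μ / 7) * (t₃₄₅ + μ / 7) - t₂₄₅ * t₂₄₅ + -t₂₃₅ * t₂₃₅
      = -(1 / 2) * (-(t₁₂₅ + t₃₄₅) ^ 2 - (4 / 7) * (t₁₂₅ + t₃₄₅) * μ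
          + (45 / 49) * μ ^ 2) := by
    linear_combination (1 / 2) * hnorm
  rw [pfaffian_eq]
  ring
end
end

section
/- Assume additionally b = (5/7)μ and μ ≠ 0. Then the kernel E² := { X ∈ ℝ⁵ : X ⌟ T = 0 } of the reduced 5-dimensional torsion form T is a linear subspace of dimension exactly 2, and E² is contained in the span of f₁, f₂, f₃, f₄. -/
noncomputable section

/-- A submodule of `E5` parametrized by two of its coordinates has dimension two. -/
theorem finrank_eq_two_of_existsUnique (K : Submodule ℝ E5) (i j : Fin 5)
    (h : ∀ a b : ℝ, ∃! X : E5, X ∈ K ∧ X i = a ∧ X j = b) : Module.finrank ℝ K = 2 := by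
  let φ : K →ₗ[ℝ] (Fin 2 → ℝ) :=
    { toFun := fun X => ![X.1 i, X.1 j]
      map_add' := fun X Y => by ext k; fin_cases k <;> simp
      map_smul' := fun c X => by ext k; fin_cases k <;> simp }
  have hφ : Function.Bijective φ := by
    refine ⟨fun X Y hXY => ?_, fun s => ?_⟩
    · have hi : X.1 i = Y.1 i := congrFun hXY 0
      have hj : X.1 j = Y.1 j := congrFun hXY 1
      exact Subtype.ext ((h _ _).unique ⟨X.2, rfl, rfl⟩ ⟨Y.2, hi.symm, hj.symm⟩)
    · obtain ⟨X, ⟨hX, hi, hj⟩, -⟩ := h (s 0) (s 1)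
      refine ⟨⟨X, hX⟩, ?_⟩
      ext k
      fin_cases k <;> simp [φ, hi, hj]
  simpa using (LinearEquiv.ofBijective φ hφ).finrank_eq

/-- The vectors of `E5` with vanishing last coordinate that are annihilated by the contraction
with `A·f₁₂ + p·(f₁₃ + f₂₄) + q·(−f₁₄ + f₂₃) + B·f₃₄`. -/
def contractionKernel (A p q B : ℝ) : Submodule ℝ E5 where
  carrier := {X | X 4 = 0 ∧ A * X 1 + p * X 2 - q * X 3 = 0 ∧ A * X 0 - q * X 2 - p * X 3 = 0 ∧
    p * X 0 + q * X 1 - B * X 3 = 0 ∧ q * X 0 - p * X 1 - B * X 2 = 0}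
  zero_mem' := by simp
  add_mem' := by
    rintro X Y ⟨h₁, h₂, h₃, h₄, h₅⟩ ⟨k₁, k₂, k₃, k₄, k₅⟩
    refine ⟨?_, ?_, ?_, ?_, ?_⟩ <;> simp only [PiLp.add_apply] <;> linarith
  smul_mem' := by
    rintro c X ⟨h₁, h₂, h₃, h₄, h₅⟩
    refine ⟨?_, ?_, ?_, ?_, ?_⟩ <;> simp only [PiLp.smul_apply, smul_eq_mul]
    · linear_combination c * h₁
    · linear_combination c * h₂
    · linear_combination c * h₃
    · linear_combination c * h₄
    · linear_combination c * h₅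

theorem mem_contractionKernel {A p q B : ℝ} {X : E5} :
    X ∈ contractionKernel A p q B ↔
      X 4 = 0 ∧ A * X 1 + p * X 2 - q * X 3 = 0 ∧ A * X 0 - q * X 2 - p * X 3 = 0 ∧
        p * X 0 + q * X 1 - B * X 3 = 0 ∧ q * X 0 - p * X 1 - B * X 2 = 0 :=
  Iff.rfl

theorem finrank_contractionKernel {A p q B : ℝ} (hAB : A * B = p ^ 2 + q ^ 2) (h : A + B ≠ 0) :
    Module.finrank ℝ (contractionKernel A p q B) = 2 := by
  by_cases hA : A = 0
  · have hB : B ≠ 0 := by simpa [hA] using h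
    refine finrank_eq_two_of_existsUnique _ 0 1 fun a b =>
      ⟨!₂[a, b, (q * a - p * b) / B, (p * a + q * b) / B, 0], ?_, ?_⟩
    · simp only [mem_contractionKernel]
      simp
      refine ⟨?_, ?_, ?_, ?_⟩ <;> field_simp
      · linear_combination b * hAB
      · linear_combination a * hAB
      · ring
      · ring
    · rintro X ⟨⟨h₁, h₂, h₃, h₄, h₅⟩, rfl, rfl⟩
      ext k
      fin_cases k <;> simp [h₁] <;> field_simp <;> linarith
  · refine finrank_eq_two_of_existsUnique _ 2 3 fun a b =>
      ⟨!₂[(q * a + p * b) / A, (q * b - p * a) / A, a, b, 0], ?_, ?_⟩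
    · simp only [mem_contractionKernel]
      simp
      refine ⟨?_, ?_, ?_, ?_⟩ <;> field_simp
      · ring
      · ring
      · linear_combination -b * hAB
      · linear_combination -a * hAB
    · rintro X ⟨⟨h₁, h₂, h₃, h₄, h₅⟩, rfl, rfl⟩
      ext k
      fin_cases k <;> simp [h₁] <;> field_simp <;> linarith

theorem mem_contractionKernel_iff_Tred {μ t₁₂₅ t₂₄₅ t₂₃₅ t₃₄₅ : ℝ}
    (h : (t₁₂₅ + μ / 7) + (t₃₄₅ + μ / 7) ≠ 0) (X : E5) :
    X ∈ contractionKernel (t₁₂₅ + μ / 7) t₂₄₅ t₂₃₅ (t₃₄₅ + μ / 7) ↔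
      ∀ Y Z : E5, Tred μ t₁₂₅ t₂₄₅ t₂₃₅ t₃₄₅ X Y Z = 0 := by
  rw [mem_contractionKernel]
  constructor
  · rintro ⟨h₁, h₂, h₃, h₄, h₅⟩ Y Z
    simp only [Tred, w3, h₁]
    linear_combination (Y 1 * Z 4 - Y 4 * Z 1) * h₃ - (Y 0 * Z 4 - Y 4 * Z 0) * h₂
      + (Y 2 * Z 4 - Y 4 * Z 2) * h₄ - (Y 3 * Z 4 - Y 4 * Z 3) * h₅
  · intro hT
    have h01 := hT (f 0) (f 1)
    have h23 := hT (f 2) (f 3)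
    have h04 := hT (f 0) (f 4)
    have h14 := hT (f 1) (f 4)
    have h24 := hT (f 2) (f 4)
    have h34 := hT (f 3) (f 4)
    simp [Tred, w3, f, -mul_eq_zero] at h01 h23 h04 h14 h24 h34
    refine ⟨(mul_eq_zero.mp ?_).resolve_left h, ?_, ?_, ?_, ?_⟩ <;> linarith

theorem mem_span_of_last_eq_zero {X : E5} (hX : X 4 = 0) :
    X ∈ Submodule.span ℝ ({f 0, f 1, f 2, f 3} : Set E5) := by
  have hsum : X = X 0 • f 0 + X 1 • f 1 + X 2 • f 2 + X 3 • f 3 := by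
    ext k
    fin_cases k <;> simp [f, hX]
  have hf : ∀ i, f i ∈ ({f 0, f 1, f 2, f 3} : Set E5) → ∀ c : ℝ,
      c • f i ∈ Submodule.span ℝ ({f 0, f 1, f 2, f 3} : Set E5) :=
    fun i hi c => Submodule.smul_mem _ c (Submodule.subset_span hi)
  rw [hsum]
  exact add_mem (add_mem (add_mem (hf 0 (by simp) _) (hf 1 (by simp) _)) (hf 2 (by simp) _))
    (hf 3 (by simp) _)

/-- if `b = (5/7)μ` and `μ ≠ 0`, then the kernel
`E² = {X : X ⌟ T = 0}` is a 2-dimensional linear subspace contained in the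
span of `f₁, f₂, f₃, f₄`. -/
theorem stmt_5 (μ t₁₂₅ t₂₄₅ t₂₃₅ t₃₄₅ : ℝ)
    (hnorm : μ ^ 2 = (t₁₂₅ + μ / 7) ^ 2 + (t₃₄₅ + μ / 7) ^ 2
      + 2 * t₂₄₅ ^ 2 + 2 * t₂₃₅ ^ 2)
    (hb : t₁₂₅ + t₃₄₅ = 5 / 7 * μ) (hμ : μ ≠ 0) :
    ∃ K : Submodule ℝ E5,
      (∀ X : E5, X ∈ K ↔ ∀ Y Z : E5, Tred μ t₁₂₅ t₂₄₅ t₂₃₅ t₃₄₅ X Y Z = 0) ∧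
      Module.finrank ℝ K = 2 ∧
      (K : Set E5) ⊆ ↑(Submodule.span ℝ ({f 0, f 1, f 2, f 3} : Set E5)) := by
  have hAB : (t₁₂₅ + μ / 7) + (t₃₄₅ + μ / 7) = μ := by linarith
  have hne : (t₁₂₅ + μ / 7) + (t₃₄₅ + μ / 7) ≠ 0 := by rwa [hAB]
  refine ⟨contractionKernel (t₁₂₅ + μ / 7) t₂₄₅ t₂₃₅ (t₃₄₅ + μ / 7),
    mem_contractionKernel_iff_Tred hne, finrank_contractionKernel ?_ hne,
    fun X hX => mem_span_of_last_eq_zero hX.1⟩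
  linear_combination hnorm / 2 + ((t₁₂₅ + μ / 7) + (t₃₄₅ + μ / 7) + μ) / 2 * hAB
end
end

section
/- Assume additionally b = −(2/7)μ and that (f₅ ⌟ T) ∧ (f₅ ⌟ T) = 0. Then μ = 0 and the reduced 5-dimensional torsion form T vanishes identically, T = 0. (In other words, the case b = −2μ/7 is impossible for nonzero torsion.) -/
noncomputable section

/-- The coefficient of `f₁₂₃₄` in `(f₅ ⌟ T) ∧ (f₅ ⌟ T)`. -/
theorem wedgeSq_Tred_basis (μ t₁₂₅ t₂₄₅ t₂₃₅ t₃₄₅ : ℝ) :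
    wedgeSq (fun X Y => Tred μ t₁₂₅ t₂₄₅ t₂₃₅ t₃₄₅ (f 4) X Y) (f 0) (f 1) (f 2) (f 3)
      = 2 * ((t₁₂₅ + μ / 7) * (t₃₄₅ + μ / 7) - t₂₄₅ ^ 2 - t₂₃₅ ^ 2) := by
  simp [wedgeSq, Tred, w3, f]
  ring

/-- if `b = −(2/7)μ` and `(f₅ ⌟ T) ∧ (f₅ ⌟ T) = 0`, then `μ = 0`
and `T = 0`; i.e. the case `b = −2μ/7` is impossible for nonzero torsion. -/
theorem stmt_6 (μ t₁₂₅ t₂₄₅ t₂₃₅ t₃₄₅ : ℝ)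
    (hnorm : μ ^ 2 = (t₁₂₅ + μ / 7) ^ 2 + (t₃₄₅ + μ / 7) ^ 2
      + 2 * t₂₄₅ ^ 2 + 2 * t₂₃₅ ^ 2)
    (hb : t₁₂₅ + t₃₄₅ = -(2 / 7) * μ)
    (hwedge : ∀ X₁ X₂ X₃ X₄ : E5,
      wedgeSq (fun X Y => Tred μ t₁₂₅ t₂₄₅ t₂₃₅ t₃₄₅ (f 4) X Y) X₁ X₂ X₃ X₄ = 0) :
    μ = 0 ∧ ∀ X Y Z : E5, Tred μ t₁₂₅ t₂₄₅ t₂₃₅ t₃₄₅ X Y Z = 0 := by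
  have hcoef := wedgeSq_Tred_basis μ t₁₂₅ t₂₄₅ t₂₃₅ t₃₄₅
  rw [hwedge] at hcoef
  have hB : t₃₄₅ + μ / 7 = -(t₁₂₅ + μ / 7) := by linarith
  rw [hB] at hnorm hcoef
  have hA : t₁₂₅ + μ / 7 = 0 := by
    refine sq_eq_zero_iff.mp ?_
    nlinarith [sq_nonneg (t₁₂₅ + μ / 7), sq_nonneg t₂₄₅, sq_nonneg t₂₃₅]
  rw [hA] at hnorm hcoef
  have h245 : t₂₄₅ = 0 := sq_eq_zero_iff.mp (by nlinarith [sq_nonneg t₂₄₅, sq_nonneg t₂₃₅])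
  have h235 : t₂₃₅ = 0 := sq_eq_zero_iff.mp (by nlinarith [sq_nonneg t₂₄₅, sq_nonneg t₂₃₅])
  refine ⟨by simpa [h245, h235] using hnorm, fun X Y Z => ?_⟩
  simp [Tred, hB, hA, h245, h235]
end
end
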